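/- In the indirect-measurement setup under a conservation law, for every density matrix ρ_S on S one has |Tr[ρ_S(A_S B_S − B_S A_S)]|² ≤ 4 (I_SLD(ρ_S, A_S) + I_SLD(ρ_E, A_E)) · Tr[(ρ_S ⊗ ρ_E) N²], where I_SLD is computed from spectral decompositions of ρ_S and ρ_E respectively. (Equivalently, ε(ρ_S)² ≥ |⟨[A_S,B_S]⟩_{ρ_S}|² / (4(I_SLD(ρ_S,A_S) + I_SLD(ρ_E,A_E))) whenever the denominator is nonzero.) -/

import Mathlib

open Matrix Kronecker
open scoped ComplexOrder

/-- The SLD skew information `I_SLD(σ,A) = (1/2) Σ_{i,j} (p_i−p_j)²/(p_i+p_j) |v_i† A v_j|²`,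
expressed via a spectral decomposition of `σ` with eigenvalues `p` and orthonormal
eigenvectors `v`.  (Terms with `p i + p j = 0` vanish, since division by zero is zero.) -/
noncomputable def sldSkew {n : ℕ} (p : Fin n → ℝ) (v : Fin n → Fin n → ℂ)
    (A : Matrix (Fin n) (Fin n) ℂ) : ℝ :=
  (1 / 2) * ∑ i, ∑ j, (p i - p j) ^ 2 / (p i + p j) * ‖star (v i) ⬝ᵥ A.mulVec (v j)‖ ^ 2

/-- The noise operator `N := B_S ⊗ 1_E − U† (1_S ⊗ M_E) U`. -/
noncomputable def noiseOp {dS dE : ℕ} (BS : Matrix (Fin dS) (Fin dS) ℂ)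
    (ME : Matrix (Fin dE) (Fin dE) ℂ)
    (U : Matrix (Fin dS × Fin dE) (Fin dS × Fin dE) ℂ) :
    Matrix (Fin dS × Fin dE) (Fin dS × Fin dE) ℂ :=
  BS ⊗ₖ (1 : Matrix (Fin dE) (Fin dE) ℂ) - Uᴴ * ((1 : Matrix (Fin dS) (Fin dS) ℂ) ⊗ₖ ME) * U

/-- The SLD skew information of an observable with matrix `X` in an eigenbasis of the state,
the eigenvalues of the state being `p`. -/
noncomputable def diagSkew {n : Type*} [Fintype n] (p : n → ℝ) (X : Matrix n n ℂ) : ℝ :=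
  (1 / 2) * ∑ i, ∑ j, (p i - p j) ^ 2 / (p i + p j) * ‖X i j‖ ^ 2

/-- The matrix whose columns are the vectors `v i`. -/
def columnMatrix {n : ℕ} (v : Fin n → Fin n → ℂ) : Matrix (Fin n) (Fin n) ℂ :=
  Matrix.of fun j i => v i j

theorem columnMatrix_conjTranspose_mul_self {n : ℕ} {v : Fin n → Fin n → ℂ}
    (h : ∀ i j, star (v i) ⬝ᵥ v j = if i = j then 1 else 0) :
    (columnMatrix v)ᴴ * columnMatrix v = 1 := by
  ext i j
  simpa [columnMatrix, mul_apply, dotProduct, one_apply] using h i j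

theorem columnMatrix_conj_apply {n : ℕ} (v : Fin n → Fin n → ℂ)
    (A : Matrix (Fin n) (Fin n) ℂ) (i j : Fin n) :
    ((columnMatrix v)ᴴ * A * columnMatrix v) i j = star (v i) ⬝ᵥ A.mulVec (v j) := by
  rw [Matrix.mul_assoc]
  simp [columnMatrix, mul_apply, dotProduct, mulVec]

theorem sldSkew_eq_diagSkew {n : ℕ} (p : Fin n → ℝ) (v : Fin n → Fin n → ℂ)
    (A : Matrix (Fin n) (Fin n) ℂ) :
    sldSkew p v A = diagSkew p ((columnMatrix v)ᴴ * A * columnMatrix v) := by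
  simp only [sldSkew, diagSkew, columnMatrix_conj_apply]

theorem sum_smul_vecMulVec_eq_columnMatrix {n : ℕ} (p : Fin n → ℝ) (v : Fin n → Fin n → ℂ) :
    ∑ i, (p i : ℂ) • vecMulVec (v i) (star (v i)) =
      columnMatrix v * diagonal (fun i => (p i : ℂ)) * (columnMatrix v)ᴴ := by
  ext i j
  rw [Matrix.mul_apply, Matrix.sum_apply]
  refine Finset.sum_congr rfl fun k _ => ?_
  simp [columnMatrix, vecMulVec_apply]
  ring

theorem trace_conj_diagonal {n : Type*} [Fintype n] [DecidableEq n] {V : Matrix n n ℂ}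
    (hV : Vᴴ * V = 1) (d : n → ℂ) : (V * diagonal d * Vᴴ).trace = ∑ i, d i := by
  rw [trace_mul_comm, ← Matrix.mul_assoc, hV, Matrix.one_mul, trace_diagonal]

/-- The uncertainty relation between the SLD skew information of `X` and the second moment of `Y`,
in an eigenbasis of the state. -/
theorem norm_trace_diagonal_commutator_sq_le {n : Type*} [Fintype n] [DecidableEq n]
    {p : n → ℝ} (hp : ∀ i, 0 ≤ p i) (X : Matrix n n ℂ) {Y : Matrix n n ℂ} (hY : Y.IsHermitian) :
    ‖(diagonal (fun i => (p i : ℂ)) * (X * Y - Y * X)).trace‖ ^ 2 ≤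
      4 * diagSkew p X * ((diagonal (fun i => (p i : ℂ)) * (Y * Y)).trace).re := by
  have hnorm : ∀ i j, ‖Y j i‖ = ‖Y i j‖ := fun i j => by
    rw [← hY.apply i j, norm_star]
  have hdiag : ∀ Z : Matrix n n ℂ,
      (diagonal (fun i => (p i : ℂ)) * Z).trace = ∑ i, (p i : ℂ) * Z i i := fun Z => by
    simp only [Matrix.trace, diag_apply, diagonal_mul]
  have htr : (diagonal (fun i => (p i : ℂ)) * (X * Y - Y * X)).trace =
      ∑ x : n × n, ((p x.1 - p x.2 : ℝ) : ℂ) * (X x.1 x.2 * Y x.2 x.1) := by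
    rw [hdiag]
    simp only [Matrix.sub_apply, mul_apply, Fintype.sum_prod_type, mul_sub, Finset.mul_sum,
      Finset.sum_sub_distrib, Complex.ofReal_sub, sub_mul]
    congr 1
    rw [Finset.sum_comm (f := fun i j => (p j : ℂ) * (X i j * Y j i))]
    refine Finset.sum_congr rfl fun i _ => Finset.sum_congr rfl fun j _ => ?_
    ring
  have hmom : ((diagonal (fun i => (p i : ℂ)) * (Y * Y)).trace).re =
      ∑ i, ∑ j, p i * ‖Y i j‖ ^ 2 := by
    simp only [hdiag, mul_apply, Finset.mul_sum, Complex.re_sum]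
    refine Finset.sum_congr rfl fun i _ => Finset.sum_congr rfl fun j _ => ?_
    rw [← hY.apply j i, Complex.star_def, Complex.mul_conj, ← Complex.ofReal_mul,
      Complex.ofReal_re, Complex.normSq_eq_norm_sq]
  have hsym : ∑ x : n × n, (p x.1 + p x.2) * ‖Y x.1 x.2‖ ^ 2 =
      2 * ∑ i, ∑ j, p i * ‖Y i j‖ ^ 2 := by
    simp only [Fintype.sum_prod_type, add_mul, Finset.sum_add_distrib]
    rw [Finset.sum_comm (f := fun i j => p j * ‖Y i j‖ ^ 2)]
    simp only [hnorm, two_mul]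
  have hskew : ∑ x : n × n, (p x.1 - p x.2) ^ 2 / (p x.1 + p x.2) * ‖X x.1 x.2‖ ^ 2 =
      2 * diagSkew p X := by
    simp only [Fintype.sum_prod_type, diagSkew]
    ring
  calc ‖(diagonal (fun i => (p i : ℂ)) * (X * Y - Y * X)).trace‖ ^ 2
      ≤ (∑ x : n × n, |p x.1 - p x.2| * (‖X x.1 x.2‖ * ‖Y x.1 x.2‖)) ^ 2 := by
        rw [htr]
        gcongr
        refine (norm_sum_le _ _).trans (Finset.sum_le_sum fun x _ => ?_)
        rw [norm_mul, norm_mul, Complex.norm_real, Real.norm_eq_abs, hnorm]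
    _ ≤ (∑ x : n × n, (p x.1 - p x.2) ^ 2 / (p x.1 + p x.2) * ‖X x.1 x.2‖ ^ 2) *
          ∑ x : n × n, (p x.1 + p x.2) * ‖Y x.1 x.2‖ ^ 2 := by
        refine Finset.sum_sq_le_sum_mul_sum_of_sq_le_mul _ (fun x _ => ?_) (fun x _ => ?_)
          fun x _ => le_of_eq ?_
        · have := hp x.1
          have := hp x.2
          positivity
        · have := hp x.1
          have := hp x.2
          positivity
        · rw [mul_pow, sq_abs]
          by_cases h : p x.1 + p x.2 = 0
          · have h1 : p x.1 = 0 := by linarith [hp x.1, hp x.2]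
            have h2 : p x.2 = 0 := by linarith [hp x.1, hp x.2]
            simp [h1, h2]
          · field_simp
    _ = _ := by
        rw [hskew, hsym, hmom]
        ring

/-- `|Tr ρ[L,N]|² ≤ 4 I_SLD(ρ,L) Tr ρN²` for a state `ρ` diagonalized by the unitary `V`. -/
theorem norm_trace_commutator_sq_le {n : Type*} [Fintype n] [DecidableEq n]
    {p : n → ℝ} (hp : ∀ i, 0 ≤ p i) {V : Matrix n n ℂ} (hV : Vᴴ * V = 1)
    (L : Matrix n n ℂ) {N : Matrix n n ℂ} (hN : N.IsHermitian) :
    ‖(V * diagonal (fun i => (p i : ℂ)) * Vᴴ * (L * N - N * L)).trace‖ ^ 2 ≤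
      4 * diagSkew p (Vᴴ * L * V) *
        ((V * diagonal (fun i => (p i : ℂ)) * Vᴴ * (N * N)).trace).re := by
  have hV' : V * Vᴴ = 1 := mul_eq_one_comm.mp hV
  have hconj : ∀ A B : Matrix n n ℂ, Vᴴ * A * V * (Vᴴ * B * V) = Vᴴ * (A * B) * V :=
    fun A B => by
      calc _ = Vᴴ * A * (V * Vᴴ) * B * V := by simp only [Matrix.mul_assoc]
        _ = _ := by rw [hV']; simp only [Matrix.mul_assoc, Matrix.one_mul]
  have htr : ∀ A : Matrix n n ℂ, (V * diagonal (fun i => (p i : ℂ)) * Vᴴ * A).trace =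
      (diagonal (fun i => (p i : ℂ)) * (Vᴴ * A * V)).trace := fun A => by
    rw [Matrix.mul_assoc, Matrix.mul_assoc, trace_mul_comm]
    simp only [Matrix.mul_assoc]
  have h := norm_trace_diagonal_commutator_sq_le hp (Vᴴ * L * V)
    (isHermitian_conjTranspose_mul_mul V hN)
  rwa [hconj, hconj, hconj, ← Matrix.sub_mul, ← Matrix.mul_sub, ← htr, ← htr] at h

/-- Additivity of the SLD skew information on product states. -/
theorem diagSkew_kronecker_add {m n : Type*} [Fintype m] [DecidableEq m] [Fintype n]
    [DecidableEq n] {p : m → ℝ} {q : n → ℝ} (hp : ∑ i, p i = 1) (hq : ∑ i, q i = 1)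
    (X : Matrix m m ℂ) (Y : Matrix n n ℂ) :
    diagSkew (fun x : m × n => p x.1 * q x.2)
        (X ⊗ₖ (1 : Matrix n n ℂ) + (1 : Matrix m m ℂ) ⊗ₖ Y) =
      diagSkew p X + diagSkew q Y := by
  have hscale : ∀ a b c : ℝ, (a * c - b * c) ^ 2 / (a * c + b * c) =
      c * ((a - b) ^ 2 / (a + b)) := fun a b c => by
    rcases eq_or_ne c 0 with rfl | hc
    · simp
    · rw [← sub_mul, ← add_mul, mul_pow, pow_two c, ← mul_assoc, mul_div_mul_right _ _ hc]
      ring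
  have hterm : ∀ i a j b,
      (p i * q a - p j * q b) ^ 2 / (p i * q a + p j * q b) *
        ‖(X ⊗ₖ (1 : Matrix n n ℂ) + (1 : Matrix m m ℂ) ⊗ₖ Y) (i, a) (j, b)‖ ^ 2 =
      (if a = b then q a * ((p i - p j) ^ 2 / (p i + p j) * ‖X i j‖ ^ 2) else 0) +
      (if i = j then p i * ((q a - q b) ^ 2 / (q a + q b) * ‖Y a b‖ ^ 2) else 0) := by
    intro i a j b
    rcases eq_or_ne i j with rfl | hij <;> rcases eq_or_ne a b with rfl | hab
    · simp
    · simp only [mul_comm (p i) (q _), hscale]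
      simp only [Matrix.add_apply, kroneckerMap_apply, one_apply_ne hab, one_apply_eq, if_neg hab,
        if_true, mul_zero, one_mul, zero_add, mul_assoc]
    · simp only [hscale]
      simp [hij, mul_assoc]
    · simp [hij, hab]
  simp only [diagSkew, Fintype.sum_prod_type, hterm, Finset.sum_add_distrib, mul_add,
    Finset.sum_ite_eq, Finset.mem_univ, if_true]
  congr 2
  · refine Finset.sum_congr rfl fun i _ => ?_
    rw [Finset.sum_comm]
    simp only [← Finset.sum_mul, hq, one_mul]
  · rw [Finset.sum_comm]
    simp only [Finset.sum_comm (s := (Finset.univ : Finset m)) (t := (Finset.univ : Finset n)),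
      Finset.sum_ite_eq, Finset.mem_univ, if_true, ← Finset.sum_mul, hp, one_mul]

theorem isHermitian_noiseOp {dS dE : ℕ} {BS : Matrix (Fin dS) (Fin dS) ℂ}
    {ME : Matrix (Fin dE) (Fin dE) ℂ} (hBS : BS.IsHermitian) (hME : ME.IsHermitian)
    (U : Matrix (Fin dS × Fin dE) (Fin dS × Fin dE) ℂ) : (noiseOp BS ME U).IsHermitian := by
  refine IsHermitian.sub ?_ (isHermitian_conjTranspose_mul_mul U ?_)
  · rw [IsHermitian, conjTranspose_kronecker, hBS.eq, conjTranspose_one]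
  · rw [IsHermitian, conjTranspose_kronecker, hME.eq, conjTranspose_one]

/-- Under the conservation law, the conserved quantity and the noise operator have commutator
`[A_S, B_S] ⊗ 1`. -/
theorem commutator_conserved_noiseOp {dS dE : ℕ} {AS BS : Matrix (Fin dS) (Fin dS) ℂ}
    {AE ME : Matrix (Fin dE) (Fin dE) ℂ} (hMEAE : ME * AE = AE * ME)
    {U : Matrix (Fin dS × Fin dE) (Fin dS × Fin dE) ℂ} (hU : Uᴴ * U = 1) (hU' : U * Uᴴ = 1)
    (hcons : U * (AS ⊗ₖ (1 : Matrix (Fin dE) (Fin dE) ℂ) +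
        (1 : Matrix (Fin dS) (Fin dS) ℂ) ⊗ₖ AE) =
      (AS ⊗ₖ (1 : Matrix (Fin dE) (Fin dE) ℂ) +
        (1 : Matrix (Fin dS) (Fin dS) ℂ) ⊗ₖ AE) * U) :
    (AS ⊗ₖ (1 : Matrix (Fin dE) (Fin dE) ℂ) + (1 : Matrix (Fin dS) (Fin dS) ℂ) ⊗ₖ AE) *
          noiseOp BS ME U -
        noiseOp BS ME U *
          (AS ⊗ₖ (1 : Matrix (Fin dE) (Fin dE) ℂ) + (1 : Matrix (Fin dS) (Fin dS) ℂ) ⊗ₖ AE) =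
      (AS * BS - BS * AS) ⊗ₖ (1 : Matrix (Fin dE) (Fin dE) ℂ) := by
  have hB : (AS ⊗ₖ (1 : Matrix (Fin dE) (Fin dE) ℂ) + (1 : Matrix (Fin dS) (Fin dS) ℂ) ⊗ₖ AE) *
        (BS ⊗ₖ (1 : Matrix (Fin dE) (Fin dE) ℂ)) -
      BS ⊗ₖ (1 : Matrix (Fin dE) (Fin dE) ℂ) *
        (AS ⊗ₖ (1 : Matrix (Fin dE) (Fin dE) ℂ) + (1 : Matrix (Fin dS) (Fin dS) ℂ) ⊗ₖ AE) =
      (AS * BS - BS * AS) ⊗ₖ (1 : Matrix (Fin dE) (Fin dE) ℂ) := by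
    simp only [Matrix.add_mul, Matrix.mul_add, ← mul_kronecker_mul, Matrix.one_mul,
      Matrix.mul_one, add_sub_add_right_eq_sub]
    ext ⟨i, a⟩ ⟨j, b⟩
    simp [sub_mul]
  have hM : (AS ⊗ₖ (1 : Matrix (Fin dE) (Fin dE) ℂ) + (1 : Matrix (Fin dS) (Fin dS) ℂ) ⊗ₖ AE) *
        ((1 : Matrix (Fin dS) (Fin dS) ℂ) ⊗ₖ ME) =
      (1 : Matrix (Fin dS) (Fin dS) ℂ) ⊗ₖ ME *
        (AS ⊗ₖ (1 : Matrix (Fin dE) (Fin dE) ℂ) + (1 : Matrix (Fin dS) (Fin dS) ℂ) ⊗ₖ AE) := by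
    simp only [Matrix.add_mul, Matrix.mul_add, ← mul_kronecker_mul, Matrix.one_mul,
      Matrix.mul_one, hMEAE]
  rw [noiseOp, ← hB]
  generalize AS ⊗ₖ (1 : Matrix (Fin dE) (Fin dE) ℂ) + (1 : Matrix (Fin dS) (Fin dS) ℂ) ⊗ₖ AE = L
    at hcons hM ⊢
  generalize (1 : Matrix (Fin dS) (Fin dS) ℂ) ⊗ₖ ME = M at hM ⊢
  have hcons' : L * Uᴴ = Uᴴ * L := by
    calc L * Uᴴ = Uᴴ * (U * L) * Uᴴ := by rw [← Matrix.mul_assoc, hU, Matrix.one_mul]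
      _ = Uᴴ * L * (U * Uᴴ) := by rw [hcons]; simp only [Matrix.mul_assoc]
      _ = Uᴴ * L := by rw [hU', Matrix.mul_one]
  have hcomm : L * (Uᴴ * M * U) = Uᴴ * M * U * L := by
    calc L * (Uᴴ * M * U) = L * Uᴴ * M * U := by simp only [Matrix.mul_assoc]
      _ = Uᴴ * (L * M) * U := by rw [hcons']; simp only [Matrix.mul_assoc]
      _ = Uᴴ * M * (L * U) := by rw [hM]; simp only [Matrix.mul_assoc]
      _ = Uᴴ * M * U * L := by rw [← hcons]; simp only [Matrix.mul_assoc]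
  rw [Matrix.mul_sub, Matrix.sub_mul, hcomm, sub_sub_sub_cancel_right]

/-- Improved WAY–Ozawa theorem (SLD form): in an indirect measurement of `B_S` under
the conservation law `[U, A_S⊗1 + 1⊗A_E] = 0`, with probe observable `M_E` commuting
with `A_E`, for every density matrix `ρ_S`,
`|Tr[ρ_S [A_S,B_S]]|² ≤ 4 (I_SLD(ρ_S,A_S) + I_SLD(ρ_E,A_E)) · Tr[(ρ_S⊗ρ_E) N²]`. -/
theorem improved_WAY_Ozawa_SLD {dS dE : ℕ}
    (ρS : Matrix (Fin dS) (Fin dS) ℂ) (ρE : Matrix (Fin dE) (Fin dE) ℂ)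
    (hρS : ρS.PosSemidef) (htrS : ρS.trace = 1)
    (hρE : ρE.PosSemidef) (htrE : ρE.trace = 1)
    (AS BS : Matrix (Fin dS) (Fin dS) ℂ) (hAS : AS.IsHermitian) (hBS : BS.IsHermitian)
    (AE ME : Matrix (Fin dE) (Fin dE) ℂ) (hAE : AE.IsHermitian) (hME : ME.IsHermitian)
    (hMEAE : ME * AE = AE * ME)
    (U : Matrix (Fin dS × Fin dE) (Fin dS × Fin dE) ℂ)
    (hU : Uᴴ * U = 1) (hU' : U * Uᴴ = 1)
    (hcons : U * (AS ⊗ₖ (1 : Matrix (Fin dE) (Fin dE) ℂ) +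
        (1 : Matrix (Fin dS) (Fin dS) ℂ) ⊗ₖ AE) =
      (AS ⊗ₖ (1 : Matrix (Fin dE) (Fin dE) ℂ) +
        (1 : Matrix (Fin dS) (Fin dS) ℂ) ⊗ₖ AE) * U)
    (pS : Fin dS → ℝ) (vS : Fin dS → Fin dS → ℂ)
    (hpS : ∀ i, 0 ≤ pS i)
    (horthS : ∀ i j, star (vS i) ⬝ᵥ vS j = if i = j then 1 else 0)
    (hdecS : ρS = ∑ i, (pS i : ℂ) • vecMulVec (vS i) (star (vS i)))
    (pE : Fin dE → ℝ) (vE : Fin dE → Fin dE → ℂ)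
    (hpE : ∀ i, 0 ≤ pE i)
    (horthE : ∀ i j, star (vE i) ⬝ᵥ vE j = if i = j then 1 else 0)
    (hdecE : ρE = ∑ i, (pE i : ℂ) • vecMulVec (vE i) (star (vE i))) :
    ‖(ρS * (AS * BS - BS * AS)).trace‖ ^ 2 ≤
      4 * (sldSkew pS vS AS + sldSkew pE vE AE) *
        (((ρS ⊗ₖ ρE) * (noiseOp BS ME U * noiseOp BS ME U)).trace).re := by
  have hVS : (columnMatrix vS)ᴴ * columnMatrix vS = 1 :=
    columnMatrix_conjTranspose_mul_self horthS
  have hVE : (columnMatrix vE)ᴴ * columnMatrix vE = 1 :=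
    columnMatrix_conjTranspose_mul_self horthE
  rw [sum_smul_vecMulVec_eq_columnMatrix] at hdecS hdecE
  have hsumS : ∑ i, pS i = 1 := by
    rw [hdecS, trace_conj_diagonal hVS] at htrS
    exact_mod_cast htrS
  have hsumE : ∑ i, pE i = 1 := by
    rw [hdecE, trace_conj_diagonal hVE] at htrE
    exact_mod_cast htrE
  have hV : (columnMatrix vS ⊗ₖ columnMatrix vE)ᴴ *
      (columnMatrix vS ⊗ₖ columnMatrix vE) = 1 := by
    rw [conjTranspose_kronecker, ← mul_kronecker_mul, hVS, hVE, one_kronecker_one]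
  have hρ : ρS ⊗ₖ ρE = (columnMatrix vS ⊗ₖ columnMatrix vE) *
      diagonal (fun x : Fin dS × Fin dE => ((pS x.1 * pE x.2 : ℝ) : ℂ)) *
        (columnMatrix vS ⊗ₖ columnMatrix vE)ᴴ := by
    simp only [Complex.ofReal_mul]
    rw [hdecS, hdecE, conjTranspose_kronecker, mul_kronecker_mul, mul_kronecker_mul,
      diagonal_kronecker_diagonal]
  have hL : (columnMatrix vS ⊗ₖ columnMatrix vE)ᴴ * (AS ⊗ₖ (1 : Matrix (Fin dE) (Fin dE) ℂ) +
        (1 : Matrix (Fin dS) (Fin dS) ℂ) ⊗ₖ AE) * (columnMatrix vS ⊗ₖ columnMatrix vE) =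
      ((columnMatrix vS)ᴴ * AS * columnMatrix vS) ⊗ₖ (1 : Matrix (Fin dE) (Fin dE) ℂ) +
        (1 : Matrix (Fin dS) (Fin dS) ℂ) ⊗ₖ ((columnMatrix vE)ᴴ * AE * columnMatrix vE) := by
    simp only [conjTranspose_kronecker, Matrix.mul_add, Matrix.add_mul, ← mul_kronecker_mul,
      Matrix.mul_one, hVS, hVE]
  have htrace : (ρS * (AS * BS - BS * AS)).trace =
      ((ρS ⊗ₖ ρE) * ((AS * BS - BS * AS) ⊗ₖ (1 : Matrix (Fin dE) (Fin dE) ℂ))).trace := by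
    rw [← mul_kronecker_mul, trace_kronecker, Matrix.mul_one, htrE, mul_one]
  have h := norm_trace_commutator_sq_le (p := fun x : Fin dS × Fin dE => pS x.1 * pE x.2)
    (fun x => mul_nonneg (hpS x.1) (hpE x.2)) hV
    (AS ⊗ₖ (1 : Matrix (Fin dE) (Fin dE) ℂ) + (1 : Matrix (Fin dS) (Fin dS) ℂ) ⊗ₖ AE)
    (isHermitian_noiseOp hBS hME U)
  rwa [← hρ, commutator_conserved_noiseOp hMEAE hU hU' hcons, ← htrace, hL,
    diagSkew_kronecker_add hsumS hsumE, ← sldSkew_eq_diagSkew, ← sldSkew_eq_diagSkew] at h
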